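/- Assume X has a minimal subspace segmentation {X_1, …, X_K} with no pure segment such that no sample lies in S_k ∩ S_ℓ for k ≠ ℓ and {X_1, …, X_K} is intersected nondegenerately. If d_0 ≤ d_min and n_k > d_k + (K−1)d_0 for all k, then for every partition J = {J_1, …, J_K} ∈ J(K, d, d_min) one has min_i r(X_{J_i}) = d_min. -/

import Mathlib

open Submodule Module Finset

noncomputable section

variable {m : ℕ} {ι : Type*}

/-- The subspace spanned by the subfamily of `x` indexed by `S`. -/
def spanOf (x : ι → EuclideanSpace ℝ (Fin m)) (S : Finset ι) :
    Submodule ℝ (EuclideanSpace ℝ (Fin m)) :=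
  Submodule.span ℝ (x '' (S : Set ι))

/-- The rank `r(X_S)` of the subfamily of `x` indexed by `S`. -/
def rOf (x : ι → EuclideanSpace ℝ (Fin m)) (S : Finset ι) : ℕ :=
  Module.finrank ℝ (spanOf x S)

/-- `X_S` is nondegenerate: every subfamily `X_T`, `T ⊆ S`, has rank `min |T| r(X_S)`. -/
def Nondeg (x : ι → EuclideanSpace ℝ (Fin m)) (S : Finset ι) : Prop :=
  ∀ T ⊆ S, rOf x T = min T.card (rOf x S)

/-- `span(X_S)` is a minimal sample subspace: `n(X_S) > r(X_S)` and `X_S` is nondegenerate. -/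
def IsMinimalSeg (x : ι → EuclideanSpace ℝ (Fin m)) (S : Finset ι) : Prop :=
  rOf x S < S.card ∧ Nondeg x S

/-- The component of `x i` in the orthogonal complement of `W ⊓ S'` within `W`. -/
def zComp (x : ι → EuclideanSpace ℝ (Fin m))
    (W S' : Submodule ℝ (EuclideanSpace ℝ (Fin m))) (i : ι) :
    EuclideanSpace ℝ (Fin m) :=
  (orthogonalProjection (W ⊓ (W ⊓ S')ᗮ) (x i) : EuclideanSpace ℝ (Fin m))

/-- The segmentation `{X_1, …, X_K}` is intersected nondegenerately: for every `k` and every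
subfamily indexed by `S` disjoint from `P k`, the family of components of the vectors of `X_k`
in the orthogonal complement (within `span(X_k)`) of `span(X_k) ⊓ span(X_S)` is zero or
nondegenerate. -/
def IntNondeg (x : ι → EuclideanSpace ℝ (Fin m)) {K : ℕ}
    (P : Fin K → Finset ι) : Prop :=
  ∀ (k : Fin K) (S : Finset ι), Disjoint S (P k) →
    (∀ i ∈ P k, zComp x (spanOf x (P k)) (spanOf x S) i = 0) ∨
      Nondeg (zComp x (spanOf x (P k)) (spanOf x S)) (P k)

/-- A minimal subspace segmentation of `X` with no pure segment, with index pieces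
`P 1, …, P K`. -/
structure IsMSSnp (x : ι → EuclideanSpace ℝ (Fin m)) {K : ℕ}
    (P : Fin K → Finset ι) : Prop where
  cover : ∀ i : ι, ∃ k, i ∈ P k
  disj : ∀ k ℓ, k ≠ ℓ → Disjoint (P k) (P ℓ)
  minimal : ∀ k, IsMinimalSeg x (P k)
  distinct : ∀ k ℓ, k ≠ ℓ → spanOf x (P k) ≠ spanOf x (P ℓ)

/-- The non-intersection condition for the minimal segments. -/
def NonIntersect (x : ι → EuclideanSpace ℝ (Fin m)) {K : ℕ}
    (P : Fin K → Finset ι) : Prop :=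
  ∀ (j : ι) (k ℓ : Fin K), k ≠ ℓ → x j ∉ spanOf x (P k) ⊓ spanOf x (P ℓ)

/-- The set `𝒥(K, d, dmin)`: partitions of the index set into `K` pieces, each of size
greater than `dmin`, whose segment ranks sum to at most `d`. -/
def InJSet (x : ι → EuclideanSpace ℝ (Fin m)) (K d dmin : ℕ)
    (Q : Fin K → Finset ι) : Prop :=
  (∀ i : ι, ∃ k, i ∈ Q k) ∧ (∀ k ℓ, k ≠ ℓ → Disjoint (Q k) (Q ℓ)) ∧
    (∀ k, dmin < (Q k).card) ∧ (∑ k, rOf x (Q k)) ≤ d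

/-- Spanning commutes with unions of index sets. -/
lemma spanOf_union [DecidableEq ι] (x : ι → EuclideanSpace ℝ (Fin m)) (S T : Finset ι) :
    spanOf x (S ∪ T) = spanOf x S ⊔ spanOf x T := by
  simp [spanOf, Set.image_union, Submodule.span_union]

lemma spanOf_mono (x : ι → EuclideanSpace ℝ (Fin m)) {S T : Finset ι} (h : S ⊆ T) :
    spanOf x S ≤ spanOf x T :=
  Submodule.span_mono (Set.image_mono (by exact_mod_cast h))

lemma rOf_mono (x : ι → EuclideanSpace ℝ (Fin m)) {S T : Finset ι} (h : S ⊆ T) :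
    rOf x S ≤ rOf x T :=
  Submodule.finrank_mono (spanOf_mono x h)

/-- A linear map that vanishes on `S ⊓ U` has image of `U` of dimension at most
`dim (S ⊔ U) - dim S`. -/
lemma finrank_add_finrank_map_le {E F : Type*} [AddCommGroup E] [Module ℝ E]
    [FiniteDimensional ℝ E] [AddCommGroup F] [Module ℝ F] (f : E →ₗ[ℝ] F) (S U : Submodule ℝ E)
    (h : S ⊓ U ≤ LinearMap.ker f) :
    finrank ℝ S + finrank ℝ (U.map f) ≤ finrank ℝ ↥(S ⊔ U) := by
  have h1 := Submodule.finrank_sup_add_finrank_inf_eq S U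
  have h2 := LinearMap.finrank_range_add_finrank_ker (f.domRestrict U)
  rw [LinearMap.range_domRestrict] at h2
  have h3 : finrank ℝ ↥(S ⊓ U) ≤ finrank ℝ (LinearMap.ker (f.domRestrict U)) := by
    rw [← Submodule.finrank_map_subtype_eq U (LinearMap.ker (f.domRestrict U))]
    refine Submodule.finrank_mono fun v hv => ?_
    exact ⟨⟨v, hv.2⟩, h hv, rfl⟩
  omega

/-- The span of the components is the image of the span under the orthogonal projection. -/
lemma spanOf_zComp (x : ι → EuclideanSpace ℝ (Fin m))
    (W S' : Submodule ℝ (EuclideanSpace ℝ (Fin m))) (S : Finset ι) :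
    spanOf (zComp x W S') S =
      (spanOf x S).map (W ⊓ (W ⊓ S')ᗮ).starProjection.toLinearMap := by
  rw [spanOf, spanOf, Submodule.map_span, ← Set.image_comp]
  rfl

/-- Under intersected nondegeneracy, adjoining vectors of one segment to vectors outside it
raises the rank as much as the dimensions allow. -/
lemma IntNondeg.rOf_add_min_le [DecidableEq ι] {x : ι → EuclideanSpace ℝ (Fin m)} {K : ℕ}
    {P : Fin K → Finset ι} (hnd : IntNondeg x P) {k : Fin K} {T A : Finset ι}
    (hT : Disjoint T (P k)) (hA : A ⊆ P k) :
    rOf x T + min A.card (rOf x (P k) - finrank ℝ ↥(spanOf x (P k) ⊓ spanOf x T)) ≤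
      rOf x (T ∪ A) := by
  set W := spanOf x (P k) with hW
  set S' := spanOf x T
  set V := W ⊓ (W ⊓ S')ᗮ with hV
  have hdim : rOf x (P k) - finrank ℝ ↥(W ⊓ S') = finrank ℝ V := by
    have := Submodule.finrank_add_inf_finrank_orthogonal (inf_le_left : W ⊓ S' ≤ W)
    rw [inf_comm (W ⊓ S')ᗮ W, ← hV] at this
    change finrank ℝ W - _ = _
    omega
  have hmap : spanOf (zComp x W S') (P k) = V := by
    rw [spanOf_zComp, ← hW]
    apply le_antisymm
    · rintro _ ⟨v, -, rfl⟩
      exact Submodule.starProjection_apply_mem V v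
    · intro v hv
      exact ⟨v, hv.1, Submodule.starProjection_eq_self_iff.mpr hv⟩
  have hr : rOf (zComp x W S') (P k) = finrank ℝ V := by rw [rOf, hmap]
  have hz : min A.card (finrank ℝ V) ≤ rOf (zComp x W S') A := by
    rcases hnd k T hT with h | h
    · have : rOf (zComp x W S') (P k) = 0 := by
        rw [rOf, Submodule.finrank_eq_zero, spanOf, Submodule.span_eq_bot]
        rintro _ ⟨i, hi, rfl⟩
        exact h i hi
      omega
    · rw [h A hA, hr]
  rw [hdim, rOf, rOf, spanOf_union]
  refine (Nat.add_le_add_left hz _).trans ?_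
  rw [rOf, spanOf_zComp]
  refine finrank_add_finrank_map_le _ _ _ fun v hv => ?_
  refine (Submodule.starProjection_apply_eq_zero_iff V).mpr ?_
  have hv' : v ∈ W ⊓ S' := ⟨spanOf_mono x hA hv.2, hv.1⟩
  rw [Submodule.mem_orthogonal]
  intro u hu
  exact Submodule.inner_left_of_mem_orthogonal hv' hu.2

/-- A family has rank at least the minimum of its size and the smallest segment dimension. -/
lemma IntNondeg.min_card_le_rOf [DecidableEq ι] {x : ι → EuclideanSpace ℝ (Fin m)} {K : ℕ}
    {P : Fin K → Finset ι} (hnd : IntNondeg x P) (hmss : IsMSSnp x P) {e : ℕ}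
    (he : ∀ k, e ≤ rOf x (P k)) (S : Finset ι) : min S.card e ≤ rOf x S := by
  have key : ∀ F : Finset (Fin K),
      min (F.biUnion fun k => S ∩ P k).card e ≤ rOf x (F.biUnion fun k => S ∩ P k) := by
    intro F
    induction F using Finset.induction_on with
    | empty => simp
    | insert k F hk ih =>
      rw [Finset.biUnion_insert, Finset.union_comm]
      set T := F.biUnion fun k => S ∩ P k
      have hT : Disjoint T (P k) := by
        refine (Finset.disjoint_biUnion_left _ _ _).mpr fun j hj => ?_
        exact (hmss.disj j k (by rintro rfl; exact hk hj)).mono_left Finset.inter_subset_right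
      have h1 := hnd.rOf_add_min_le hT (Finset.inter_subset_right : S ∩ P k ⊆ P k)
      have h2 : finrank ℝ ↥(spanOf x (P k) ⊓ spanOf x T) ≤ rOf x T :=
        Submodule.finrank_mono inf_le_right
      have h3 := Finset.card_union_le T (S ∩ P k)
      have h4 := he k
      omega
  have hS : (Finset.univ.biUnion fun k => S ∩ P k) = S := by
    ext i
    simpa using fun _ => hmss.cover i
  simpa [hS] using key Finset.univ

/-- A lower bound for the rank of a family in terms of its numbers of vectors in the segments. -/
lemma IntNondeg.min_add_sum_le_rOf [DecidableEq ι] {x : ι → EuclideanSpace ℝ (Fin m)} {K : ℕ}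
    {P : Fin K → Finset ι} (hnd : IntNondeg x P) (hmss : IsMSSnp x P) {d0 : ℕ}
    (hd0 : ∀ k, finrank ℝ ↥(spanOf x (P k) ⊓ ⨆ (j) (_ : j ≠ k), spanOf x (P j)) ≤ d0)
    (S : Finset ι) (k₀ : Fin K) (F : Finset (Fin K)) (hF : k₀ ∉ F) :
    min (S ∩ P k₀).card (rOf x (P k₀)) +
      ∑ k ∈ F, min (S ∩ P k).card (rOf x (P k) - d0) ≤ rOf x S := by
  have key : min (S ∩ P k₀).card (rOf x (P k₀)) +
      ∑ k ∈ F, min (S ∩ P k).card (rOf x (P k) - d0) ≤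
        rOf x ((insert k₀ F).biUnion fun k => S ∩ P k) := by
    induction F using Finset.induction_on with
    | empty =>
      simpa using ((hmss.minimal k₀).2 (S ∩ P k₀) Finset.inter_subset_right).ge
    | insert k F hk ih =>
      rw [Finset.mem_insert, not_or] at hF
      have hk' : k ∉ insert k₀ F := by
        rw [Finset.mem_insert, not_or]
        exact ⟨Ne.symm hF.1, hk⟩
      specialize ih hF.2
      rw [Finset.sum_insert hk, Finset.insert_comm, Finset.biUnion_insert, Finset.union_comm]
      set T := (insert k₀ F).biUnion fun k => S ∩ P k
      have hT : Disjoint T (P k) := by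
        refine (Finset.disjoint_biUnion_left _ _ _).mpr fun j hj => ?_
        exact (hmss.disj j k (by rintro rfl; exact hk' hj)).mono_left Finset.inter_subset_right
      have h1 := hnd.rOf_add_min_le hT (Finset.inter_subset_right : S ∩ P k ⊆ P k)
      have h2 : finrank ℝ ↥(spanOf x (P k) ⊓ spanOf x T) ≤ d0 := by
        refine (Submodule.finrank_mono (inf_le_inf_left _ ?_)).trans (hd0 k)
        refine Submodule.span_le.mpr ?_
        rintro _ ⟨i, hi, rfl⟩
        obtain ⟨j, hj, hij⟩ := Finset.mem_biUnion.mp (Finset.mem_coe.mp hi)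
        have hjk : j ≠ k := by rintro rfl; exact hk' hj
        refine (le_iSup₂_of_le (f := fun j (_ : j ≠ k) => spanOf x (P j)) j hjk le_rfl) ?_
        exact Submodule.subset_span ⟨i, (Finset.mem_inter.mp hij).2, rfl⟩
      omega
  refine key.trans (rOf_mono x ?_)
  exact Finset.biUnion_subset.mpr fun _ _ => Finset.inter_subset_left

lemma min_sum_le_sum_min {α : Type*} (s : Finset α) (f : α → ℕ) (c : ℕ) :
    min (∑ i ∈ s, f i) c ≤ ∑ i ∈ s, min (f i) c := by
  classical
  induction s using Finset.induction_on with
  | empty => simp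
  | insert a s ha ih => rw [Finset.sum_insert ha, Finset.sum_insert ha]; omega

/-- A partition by finsets counts the elements of a finset. -/
lemma sum_card_inter_of_partition [DecidableEq ι] {K : ℕ} {Q : Fin K → Finset ι}
    (hcov : ∀ i, ∃ k, i ∈ Q k) (hdisj : ∀ k ℓ, k ≠ ℓ → Disjoint (Q k) (Q ℓ)) (S : Finset ι) :
    ∑ i, (Q i ∩ S).card = S.card := by
  rw [← Finset.card_biUnion]
  · congr 1
    ext i
    simpa using fun _ => hcov i
  · intro i _ j _ hij
    exact (hdisj i j hij).mono Finset.inter_subset_left Finset.inter_subset_left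

/-- If `d_0 ≤ d_min` and `n_k > d_k + (K−1)·d_0` for all `k`, then for every
partition in `𝒥(K, d, dmin)` the minimum of the segment ranks equals `d_min`. -/
theorem min_rank_eq_dmin [Fintype ι] [DecidableEq ι]
    (x : ι → EuclideanSpace ℝ (Fin m)) {K : ℕ} (P : Fin K → Finset ι)
    (hmss : IsMSSnp x P) (hni : NonIntersect x P) (hnd : IntNondeg x P)
    (d dmin d0 : ℕ)
    (hd : d = ∑ k, rOf x (P k))
    (hdmin : IsLeast (Set.range fun k => rOf x (P k)) dmin)
    (hd0 : IsGreatest (Set.range fun k =>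
      Module.finrank ℝ ↥(spanOf x (P k) ⊓ ⨆ (j) (_ : j ≠ k), spanOf x (P j))) d0)
    (h2 : d0 ≤ dmin)
    (h3 : ∀ k, rOf x (P k) + (K - 1) * d0 < (P k).card)
    (Q : Fin K → Finset ι) (hQ : InJSet x K d dmin Q) :
    IsLeast (Set.range fun i => rOf x (Q i)) dmin := by
  classical
  obtain ⟨hcov, hdisj, hcard, hsum⟩ := hQ
  obtain ⟨⟨kmin, hkmin⟩, hle⟩ := hdmin
  have hle : ∀ k, dmin ≤ rOf x (P k) := fun k => hle ⟨k, rfl⟩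
  have hkmin : rOf x (P kmin) = dmin := hkmin
  have hd0 : ∀ k, finrank ℝ ↥(spanOf x (P k) ⊓ ⨆ (j) (_ : j ≠ k), spanOf x (P j)) ≤ d0 :=
    fun k => hd0.2 ⟨k, rfl⟩
  have hlow : ∀ i, dmin ≤ rOf x (Q i) := fun i => by
    have h1 := hnd.min_card_le_rOf hmss hle (Q i)
    have h2 := hcard i
    omega
  have hcount := fun k => sum_card_inter_of_partition hcov hdisj (P k)
  have hdecomp : ∑ k, (rOf x (P k) - d0) + K * d0 = d := by
    have : K * d0 = ∑ _k : Fin K, d0 := by simp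
    rw [hd, this, ← Finset.sum_add_distrib]
    exact Finset.sum_congr rfl fun k _ => Nat.sub_add_cancel (h2.trans (hle k))
  refine ⟨?_, by rintro _ ⟨i, rfl⟩; exact hlow i⟩
  by_contra hcon
  have hgt : ∀ i, dmin < rOf x (Q i) := fun i =>
    (hlow i).lt_of_ne fun h => hcon ⟨i, h.symm⟩
  by_cases hbig : ∀ k, ∃ i, rOf x (P k) ≤ (Q i ∩ P k).card
  · choose σ hσ using hbig
    have hrow : ∀ i, ∑ k with σ k = i, (rOf x (P k) - d0) + d0 ≤ rOf x (Q i) := by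
      intro i
      rcases (Finset.univ.filter fun k => σ k = i).eq_empty_or_nonempty with h | ⟨k₀, hk₀⟩
      · rw [h, Finset.sum_empty]
        have := hlow i
        omega
      · have h1 := hnd.min_add_sum_le_rOf hmss hd0 (Q i) k₀
          ((Finset.univ.filter fun k => σ k = i).erase k₀) (Finset.notMem_erase _ _)
        rw [← Finset.add_sum_erase _ _ hk₀]
        have h3 : ∑ k ∈ (Finset.univ.filter fun k => σ k = i).erase k₀, (rOf x (P k) - d0) ≤
            ∑ k ∈ (Finset.univ.filter fun k => σ k = i).erase k₀,
              min (Q i ∩ P k).card (rOf x (P k) - d0) := by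
          refine Finset.sum_le_sum fun k hk => ?_
          have hk' := (Finset.mem_filter.mp (Finset.mem_of_mem_erase hk)).2
          have := hσ k
          rw [hk'] at this
          omega
        have h4 := hσ k₀
        rw [(Finset.mem_filter.mp hk₀).2] at h4
        have h5 := hle k₀
        omega
    have hstrict : ∃ i, ∑ k with σ k = i, (rOf x (P k) - d0) + d0 < rOf x (Q i) := by
      by_cases hinj : Function.Injective σ
      · refine ⟨σ kmin, ?_⟩
        have : (Finset.univ.filter fun k => σ k = σ kmin) = {kmin} := by
          ext k
          simp [hinj.eq_iff]
        rw [this, Finset.sum_singleton]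
        have := hgt (σ kmin)
        omega
      · rw [Finite.injective_iff_surjective] at hinj
        simp only [Function.Surjective, not_forall, not_exists] at hinj
        obtain ⟨i, hi⟩ := hinj
        refine ⟨i, ?_⟩
        rw [Finset.filter_false_of_mem fun k _ => hi k, Finset.sum_empty]
        have := hgt i
        omega
    obtain ⟨i, hi⟩ := hstrict
    have h1 := Finset.sum_lt_sum (fun i _ => hrow i) ⟨i, Finset.mem_univ i, hi⟩
    rw [Finset.sum_add_distrib, Finset.sum_fiberwise] at h1
    simp only [Finset.sum_const, Finset.card_univ, Fintype.card_fin, smul_eq_mul] at h1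
    omega
  · push Not at hbig
    obtain ⟨k₀, hk₀⟩ := hbig
    have h1 := Finset.sum_le_sum fun i (_ : i ∈ Finset.univ) =>
      hnd.min_add_sum_le_rOf hmss hd0 (Q i) k₀ (Finset.univ.erase k₀) (Finset.notMem_erase _ _)
    rw [Finset.sum_add_distrib, Finset.sum_comm,
      Finset.sum_congr rfl fun i _ => min_eq_left (hk₀ i).le, hcount] at h1
    have h4 : ∑ k ∈ Finset.univ.erase k₀, (rOf x (P k) - d0) ≤
        ∑ k ∈ Finset.univ.erase k₀, ∑ i, min (Q i ∩ P k).card (rOf x (P k) - d0) := by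
      refine Finset.sum_le_sum fun k _ => ?_
      have h5 := min_sum_le_sum_min Finset.univ (fun i => (Q i ∩ P k).card) (rOf x (P k) - d0)
      rw [hcount] at h5
      have := h3 k
      omega
    rw [← Finset.add_sum_erase _ _ (Finset.mem_univ k₀)] at hdecomp
    have h6 := h3 k₀
    have h8 := hle k₀
    have h7 : K * d0 = (K - 1) * d0 + d0 := by
      rw [← Nat.succ_mul, Nat.succ_eq_add_one, Nat.sub_add_cancel k₀.pos]
    omega
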